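/- Let T be a tree with a linear order (v_1,…,v_n) of V(T) of bandwidth at most b, let G be obtained from T by subdividing each edge e once (vertex w_e) and attaching ℓ = 2b² leaves to each original vertex, and let k = ℓ(b−1)/2 + 2b − 2. Then G admits a 2-layer k-planar drawing with parts X = V(T) (ordered by the given order) and Y = V(G)∖V(T). -/

import Mathlib

open Function

/-- Two edges of a 2-layer drawing cross. -/
def cross2 {X Y : Type*} (πX : X → ℕ) (πY : Y → ℕ) (e f : X × Y) : Prop :=
  (πX e.1 < πX f.1 ∧ πY f.2 < πY e.2) ∨ (πX f.1 < πX e.1 ∧ πY e.2 < πY f.2)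

/-- A 2-layer drawing is `k`-planar: every edge is crossed by at most `k` edges. -/
def TwoLayerKPlanar {X Y : Type*} (k : ℕ) (πX : X → ℕ) (πY : Y → ℕ)
    (E : Set (X × Y)) : Prop :=
  ∀ e ∈ E, {f | f ∈ E ∧ cross2 πX πY e f}.ncard ≤ k

/-- The lower layer of the subdivision construction: one subdivision vertex
`w_e` per edge `e` of `T`, plus `ℓ` pendant leaves for each vertex of `T`. -/
def SubY {V : Type*} (T : SimpleGraph V) (ℓ : ℕ) : Type _ :=
  (↥T.edgeSet) ⊕ (V × Fin ℓ)

/-- The edges of the graph obtained from `T` by subdividing each edge once and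
attaching `ℓ` leaves to each original vertex, as a bipartite edge set between
`X = V(T)` and `Y = SubY T ℓ`. -/
def subEdges {V : Type*} (T : SimpleGraph V) (ℓ : ℕ) : Set (V × SubY T ℓ) :=
  {p | (∃ e : ↥T.edgeSet, p.2 = Sum.inl e ∧ p.1 ∈ (e : Sym2 V)) ∨
       (∃ q : V × Fin ℓ, p.2 = Sum.inr q ∧ p.1 = q.1)}

/-- `T` has bandwidth at most `b`. -/
def BandwidthLE {V : Type*} [Fintype V] (T : SimpleGraph V) (b : ℕ) : Prop :=
  ∃ σ : V ≃ Fin (Fintype.card V), ∀ u v, T.Adj u v →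
    (σ u : ℕ) ≤ (σ v : ℕ) + b ∧ (σ v : ℕ) ≤ (σ u : ℕ) + b

open Classical in
lemma forest_card {V : Type*} [Fintype V] (T : SimpleGraph V) (hT : T.IsAcyclic)
    (F : Finset T.edgeSet) (S : Finset V) (hS : S.Nonempty)
    (h : ∀ e ∈ F, ∀ v ∈ e.1, v ∈ S) : F.card + 1 ≤ S.card := by
  have hne : Nonempty (S : Set V) := ⟨⟨_, hS.choose_spec⟩⟩
  obtain ⟨T', hle, hT'⟩ :=
    (SimpleGraph.connected_top (V := (S : Set V))).exists_isTree_le_of_le_of_isAcyclic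
      (H := T.induce (S : Set V)) le_top (hT.induce _)
  have hc := hT'.2.card_edgeFinset
  have hS' : Fintype.card (S : Set V) = S.card := by simp
  rw [hS'] at hc
  rw [← hc]
  have h1 : F.image Subtype.val ⊆ T'.edgeFinset.image (Sym2.map Subtype.val) := by
    intro f hf
    rw [Finset.mem_image] at hf ⊢
    obtain ⟨⟨f', hf'⟩, hfF, rfl⟩ := hf
    induction f' using Sym2.ind with
    | _ a c =>
      have ha := h _ hfF a (by simp)
      have hc := h _ hfF c (by simp)
      refine ⟨s(⟨a, ha⟩, ⟨c, hc⟩), ?_, by simp⟩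
      rw [SimpleGraph.mem_edgeFinset, SimpleGraph.mem_edgeSet]
      apply hle
      simpa using hf'
  have h2 := Finset.card_le_card h1
  rw [Finset.card_image_of_injective _ Subtype.val_injective] at h2
  have := Finset.card_image_le (s := T'.edgeFinset) (f := Sym2.map Subtype.val)
  omega

open Classical in
lemma forest_window {V : Type*} [Fintype V] (T : SimpleGraph V) (hT : T.IsAcyclic)
    (p : V → ℕ) (hp : Injective p)
    (F : Finset T.edgeSet) (c lo w : ℕ) (hw : 1 ≤ w)
    (h : ∀ e ∈ F, ∀ v ∈ e.1, lo ≤ p v + c ∧ p v + c < lo + w) : F.card + 1 ≤ w := by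
  set S : Finset V := Finset.univ.filter (fun v => lo ≤ p v + c ∧ p v + c < lo + w) with hSdef
  have hSw : S.card ≤ w := by
    have : S.card ≤ (Finset.Ico lo (lo + w)).card := by
      apply Finset.card_le_card_of_injOn (fun v => p v + c)
      · intro v hv
        simp only [hSdef, Finset.coe_filter, Finset.mem_univ, true_and, Set.mem_ofPred_eq] at hv
        simpa using hv
      · intro a _ d _ had
        exact hp (by simpa using had)
    simpa using this
  by_cases hS : S.Nonempty
  · have := forest_card T hT F S hS (fun e he v hv => by simpa [hSdef] using h e he v hv)
    omega
  · have : F = ∅ := by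
      rw [Finset.eq_empty_iff_forall_notMem]
      rintro ⟨e, he⟩ heF
      induction e using Sym2.ind with
      | _ a d =>
        exact hS ⟨a, by simpa [hSdef] using h _ heF a (by simp)⟩
    subst this
    simpa using hw

open Classical in
noncomputable def halfCross {V : Type*} [Fintype V] (T : SimpleGraph V) (p : V → ℕ)
    (r : T.edgeSet → ℕ) (x : V) (e : T.edgeSet) : Finset (V × T.edgeSet) :=
  Finset.univ.filter (fun q => q.1 ∈ q.2.1 ∧
    ((p x < p q.1 ∧ r q.2 < r e) ∨ (p q.1 < p x ∧ r e < r q.2)))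

lemma edge_other {V : Type*} (T : SimpleGraph V) (b : ℕ) (p : V → ℕ) (hp : Injective p)
    (hband : ∀ u v, T.Adj u v → p u ≤ p v + b ∧ p v ≤ p u + b)
    (m : T.edgeSet → ℕ) (hm : ∀ e x y, e.1 = s(x, y) → m e = p x + p y)
    (f : T.edgeSet) (z : V) (hz : z ∈ f.1) :
    ∃ z', f.1 = s(z, z') ∧ m f = p z + p z' ∧ p z ≠ p z' ∧ p z ≤ p z' + b ∧ p z' ≤ p z + b := by
  obtain ⟨z', hz'⟩ := hz
  have hadj : T.Adj z z' := by
    have := f.2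
    rw [hz'] at this
    simpa using this
  refine ⟨z', hz', hm f z z' hz', fun h => hadj.ne (hp h), hband _ _ hadj⟩

lemma fiber_two {V : Type*} [Fintype V] [DecidableEq V] (T : SimpleGraph V) [DecidableEq T.edgeSet]
    (Q : Finset (V × T.edgeSet)) (hQ : ∀ q ∈ Q, q.1 ∈ q.2.1) :
    Q.card ≤ 2 * (Q.image Prod.snd).card := by
  apply Finset.card_le_mul_card_image
  rintro ⟨e, he⟩ _
  induction e using Sym2.ind with
  | _ a c =>
    calc _ ≤ ({a, c} : Finset V).card := by
          apply Finset.card_le_card_of_injOn Prod.fst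
          · rintro ⟨z, f⟩ hq
            simp only [Finset.coe_filter, Set.mem_ofPred_eq] at hq
            have := hQ _ hq.1
            rw [hq.2] at this
            simpa using this
          · rintro ⟨z, f⟩ hq ⟨z', f'⟩ hq' h
            simp only [Finset.coe_filter, Set.mem_ofPred_eq] at hq hq' h
            rw [hq.2, hq'.2, h]
      _ ≤ 2 := Finset.card_le_two

lemma halfCross_le {V : Type*} [Fintype V] (T : SimpleGraph V) (hT : T.IsAcyclic)
    (b : ℕ) (p : V → ℕ) (hp : Injective p)
    (hband : ∀ u v, T.Adj u v → p u ≤ p v + b ∧ p v ≤ p u + b)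
    (m r : T.edgeSet → ℕ) (hm : ∀ e x y, e.1 = s(x, y) → m e = p x + p y)
    (hr : ∀ e f, m e < m f → r e < r f) (x : V) (e : T.edgeSet) (hx : x ∈ e.1) :
    (halfCross T p r x e).card ≤ 4 * b - 4 := by
  classical
  obtain ⟨y, hey, hme, hne, hb1, hb2⟩ := edge_other T b p hp hband m hm e x hx
  have hb : 1 ≤ b := by omega
  have h2 := fiber_two T (halfCross T p r x e) (fun q hq => by
    simp only [halfCross, Finset.mem_filter] at hq
    exact hq.2.1)
  set F := (halfCross T p r x e).image Prod.snd with hF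
  have hmem : ∀ f ∈ F, ∃ z z', f.1 = s(z, z') ∧ m f = p z + p z' ∧ p z ≠ p z' ∧ p z ≤ p z' + b ∧
      p z' ≤ p z + b ∧ ((p x < p z ∧ r f < r e) ∨ (p z < p x ∧ r e < r f)) := by
    intro f hf
    simp only [hF, halfCross, Finset.mem_image, Finset.mem_filter] at hf
    obtain ⟨⟨z, f'⟩, ⟨-, hz, hc⟩, rfl⟩ := hf
    obtain ⟨z', h1, h2, h3, h4, h5⟩ := edge_other T b p hp hband m hm f' z hz
    exact ⟨z, z', h1, h2, h3, h4, h5, hc⟩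
  have heF : e ∉ F := by
    intro h
    obtain ⟨z, z', -, -, -, -, -, h⟩ := hmem e h
    omega
  have hw : (insert e F).card + 1 ≤ 2 * b := by
    by_cases hxy : p x < p y
    · apply forest_window T hT p hp _ b (p x + 1) (2 * b) (by omega)
      intro f hf v hv
      rcases Finset.mem_insert.1 hf with rfl | hf
      · rw [hey, Sym2.mem_iff] at hv
        rcases hv with rfl | rfl <;> omega
      · obtain ⟨z, z', h1, h2, h3, h4, h5, hc⟩ := hmem f hf
        rw [h1, Sym2.mem_iff] at hv
        have := hr e f
        have := hr f e
        rcases hv with rfl | rfl <;> omega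
    · apply forest_window T hT p hp _ b (p x) (2 * b) (by omega)
      intro f hf v hv
      rcases Finset.mem_insert.1 hf with rfl | hf
      · rw [hey, Sym2.mem_iff] at hv
        rcases hv with rfl | rfl <;> omega
      · obtain ⟨z, z', h1, h2, h3, h4, h5, hc⟩ := hmem f hf
        rw [h1, Sym2.mem_iff] at hv
        have := hr e f
        have := hr f e
        rcases hv with rfl | rfl <;> omega
  rw [Finset.card_insert_of_notMem heF] at hw
  omega

lemma halfCross_long {V : Type*} [Fintype V] (T : SimpleGraph V) (hT : T.IsAcyclic)
    (b : ℕ) (p : V → ℕ) (hp : Injective p)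
    (hband : ∀ u v, T.Adj u v → p u ≤ p v + b ∧ p v ≤ p u + b)
    (m r : T.edgeSet → ℕ) (hm : ∀ e x y, e.1 = s(x, y) → m e = p x + p y)
    (hr : ∀ e f, m e < m f → r e < r f)
    (x y : V) (e : T.edgeSet) (hxy : e.1 = s(x, y))
    (hlong : p y = p x + b) :
    (halfCross T p r x e).card + (halfCross T p r y e).card ≤ 4 * b - 4 := by
  classical
  have hme := hm e x y hxy
  have hb : 1 ≤ b := by
    obtain ⟨y', h1, h2, h3, h4, h5⟩ := edge_other T b p hp hband m hm e x (by rw [hxy]; simp)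
    omega
  set D : Finset (V × T.edgeSet) := Finset.univ.filter
    (fun q => q.1 ∈ q.2.1 ∧ p x < p q.1 ∧ p q.1 < p y) with hD
  have hsub : ∀ z f, z ∈ f.1 → ((p x < p z ∧ r f < r e) ∨ (p z < p x ∧ r e < r f)) →
      p x < p z ∧ p z < p y ∧ r f < r e := by
    intro z f hz hc
    obtain ⟨z', h1, h2, h3, h4, h5⟩ := edge_other T b p hp hband m hm f z hz
    have := hr e f
    have := hr f e
    have hzy : ¬ (p z = p y ∧ p z' = p x) := by
      rintro ⟨h, h'⟩
      have : f = e := Subtype.ext (by rw [h1, hxy, hp h, hp h', Sym2.eq_swap])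
      subst this
      omega
    omega
  have hsub' : ∀ z f, z ∈ f.1 → ((p y < p z ∧ r f < r e) ∨ (p z < p y ∧ r e < r f)) →
      p x < p z ∧ p z < p y ∧ r e < r f := by
    intro z f hz hc
    obtain ⟨z', h1, h2, h3, h4, h5⟩ := edge_other T b p hp hband m hm f z hz
    have := hr e f
    have := hr f e
    have hzy : ¬ (p z = p x ∧ p z' = p y) := by
      rintro ⟨h, h'⟩
      have : f = e := Subtype.ext (by rw [h1, hxy, hp h, hp h'])
      subst this
      omega
    omega
  have hle : (halfCross T p r x e).card + (halfCross T p r y e).card ≤ D.card := by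
    rw [← Finset.card_union_of_disjoint]
    · apply Finset.card_le_card
      rintro ⟨z, f⟩ hq
      simp only [halfCross, Finset.mem_union, Finset.mem_filter, Finset.mem_univ, true_and] at hq
      simp only [hD, Finset.mem_filter, Finset.mem_univ, true_and]
      rcases hq with ⟨hz, hc⟩ | ⟨hz, hc⟩
      · have := hsub z f hz hc
        exact ⟨hz, this.1, this.2.1⟩
      · have := hsub' z f hz hc
        exact ⟨hz, this.1, this.2.1⟩
    · rw [Finset.disjoint_left]
      rintro ⟨z, f⟩ hq hq'
      simp only [halfCross, Finset.mem_filter, Finset.mem_univ, true_and] at hq hq'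
      have h1 := hsub z f hq.1 hq.2
      have h2 := hsub' z f hq'.1 hq'.2
      omega
  rcases Nat.lt_or_ge b 2 with hb2 | hb2
  · have : D = ∅ := by
      rw [Finset.eq_empty_iff_forall_notMem]
      rintro ⟨z, f⟩ hq
      simp only [hD, Finset.mem_filter, Finset.mem_univ, true_and] at hq
      omega
    rw [this, Finset.card_empty] at hle
    omega
  set F : Finset T.edgeSet := Finset.univ.filter
    (fun f => ∃ z ∈ f.1, p x < p z ∧ p z < p y) with hF
  set A : Finset T.edgeSet := Finset.univ.filter
    (fun f => ∀ z ∈ f.1, p x < p z ∧ p z < p y) with hA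
  have hFcard : (insert e F).card + 1 ≤ 3 * b - 1 := by
    apply forest_window T hT p hp _ b (p x + 1) _ (by omega)
    intro f hf v hv
    rcases Finset.mem_insert.1 hf with rfl | hf
    · rw [hxy, Sym2.mem_iff] at hv
      rcases hv with rfl | rfl <;> omega
    · simp only [hF, Finset.mem_filter, Finset.mem_univ, true_and] at hf
      obtain ⟨z, hz, hz1, hz2⟩ := hf
      obtain ⟨z', h1, h2, h3, h4, h5⟩ := edge_other T b p hp hband m hm f z hz
      rw [h1, Sym2.mem_iff] at hv
      rcases hv with rfl | rfl <;> omega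
  have heF : e ∉ F := by
    intro h
    simp only [hF, Finset.mem_filter, Finset.mem_univ, true_and] at h
    obtain ⟨z, hz, hz1, hz2⟩ := h
    rw [hxy, Sym2.mem_iff] at hz
    rcases hz with rfl | rfl <;> omega
  rw [Finset.card_insert_of_notMem heF] at hFcard
  have hAcard : A.card + 1 ≤ b - 1 := by
    apply forest_window T hT p hp _ 0 (p x + 1) _ (by omega)
    intro f hf v hv
    simp only [hA, Finset.mem_filter, Finset.mem_univ, true_and] at hf
    have := hf v hv
    omega
  have hDcard : D.card ≤ F.card + A.card := by
    rw [← Finset.card_filter_add_card_filter_not (s := D)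
      (p := fun q => ∃ z', q.2.1 = s(q.1, z') ∧ p x < p z' ∧ p z' < p q.1), add_comm]
    apply add_le_add
    · apply Finset.card_le_card_of_injOn Prod.snd
      · rintro ⟨z, f⟩ hq
        simp only [hD, Finset.coe_filter, Finset.mem_filter, Finset.mem_univ, true_and,
          Set.mem_ofPred_eq] at hq
        simp only [hF, Finset.coe_filter, Finset.mem_univ, true_and, Set.mem_ofPred_eq]
        exact ⟨z, hq.1⟩
      · rintro ⟨z, f⟩ hq ⟨z', f'⟩ hq' h
        simp only [hD, Finset.coe_filter, Finset.mem_filter, Finset.mem_univ, true_and,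
          Set.mem_ofPred_eq] at hq hq' h
        subst h
        by_contra hcon
        have hzz : z ≠ z' := fun h => hcon (by rw [h])
        have hf := (Sym2.mem_and_mem_iff hzz).1 ⟨hq.1.1, hq'.1.1⟩
        have hpz : p z ≠ p z' := fun h => hzz (hp h)
        rcases Nat.lt_or_gt_of_ne hpz with hlt | hlt
        · exact hq'.2 ⟨z, by rw [hf, Sym2.eq_swap], hq.1.2.1, hlt⟩
        · exact hq.2 ⟨z', hf, hq'.1.2.1, hlt⟩
    · apply Finset.card_le_card_of_injOn Prod.snd
      · rintro ⟨z, f⟩ hq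
        simp only [hD, Finset.coe_filter, Finset.mem_filter, Finset.mem_univ, true_and,
          Set.mem_ofPred_eq] at hq
        simp only [hA, Finset.coe_filter, Finset.mem_univ, true_and, Set.mem_ofPred_eq]
        obtain ⟨⟨hz, h1, h2⟩, z', hf, h3, h4⟩ := hq
        intro v hv
        rw [hf, Sym2.mem_iff] at hv
        rcases hv with rfl | rfl <;> omega
      · rintro ⟨z, f⟩ hq ⟨z', f'⟩ hq' h
        simp only [hD, Finset.coe_filter, Finset.mem_filter, Finset.mem_univ, true_and,
          Set.mem_ofPred_eq] at hq hq' h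
        subst h
        obtain ⟨⟨hz, h1, h2⟩, u, hf, h3, h4⟩ := hq
        obtain ⟨⟨hz', h1', h2'⟩, u', hf', h3', h4'⟩ := hq'
        rw [hf, Sym2.eq_iff] at hf'
        rcases hf' with ⟨rfl, -⟩ | ⟨rfl, rfl⟩
        · rfl
        · omega
  omega

lemma lex_lt (N a a' s s' : ℕ) (hs : s < N) (hs' : s' < N) :
    N * a + s < N * a' + s' ↔ a < a' ∨ (a = a' ∧ s < s') := by
  rcases Nat.lt_trichotomy a a' with h | h | h
  · have := Nat.mul_le_mul_left N (Nat.succ_le_of_lt h)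
    rw [Nat.mul_succ] at this
    omega
  · subst h
    omega
  · have := Nat.mul_le_mul_left N (Nat.succ_le_of_lt h)
    rw [Nat.mul_succ] at this
    omega

lemma exists_code {V : Type*} [Fintype V] (T : SimpleGraph V) (m : T.edgeSet → ℕ) :
    ∃ r : T.edgeSet → ℕ, Injective r ∧ ∀ e f, m e < m f → r e < r f := by
  classical
  let c := Fintype.equivFin T.edgeSet
  refine ⟨fun e => Fintype.card T.edgeSet * m e + c e, ?_, ?_⟩
  · intro e f h
    have h1 := lex_lt _ (m e) (m f) (c e) (c f) (c e).2 (c f).2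
    have h2 := lex_lt _ (m f) (m e) (c f) (c e) (c f).2 (c e).2
    have h' : Fintype.card T.edgeSet * m e + c e = Fintype.card T.edgeSet * m f + c f := h
    apply c.injective
    apply Fin.ext
    omega
  · intro e f h
    exact (lex_lt _ (m e) (m f) (c e) (c f) (c e).2 (c f).2).2 (Or.inl h)

lemma exists_pi {V : Type*} [Fintype V] (T : SimpleGraph V) (l : ℕ) (p : V → ℕ) (hp : Injective p)
    (m r : T.edgeSet → ℕ) (hr : ∀ e f, m e < m f → r e < r f) (hrinj : Injective r)
    (g : ℕ → ℕ) (hg : Monotone g) :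
    ∃ π : SubY T l → ℕ, Injective π ∧
      (∀ e f, π (Sum.inl e) < π (Sum.inl f) ↔ r e < r f) ∧
      (∀ v (t : Fin l) e, π (Sum.inr (v, t)) < π (Sum.inl e) ↔ l * p v + t < g (m e)) ∧
      (∀ v (t : Fin l) e, π (Sum.inl e) < π (Sum.inr (v, t)) ↔ g (m e) ≤ l * p v + t) ∧
      (∀ v (t : Fin l) v' (t' : Fin l), π (Sum.inr (v, t)) < π (Sum.inr (v', t')) ↔
        l * p v + t < l * p v' + t') := by
  classical
  obtain ⟨N, hN0, hN⟩ : ∃ N, 0 < N ∧ ∀ e, r e + 1 < N :=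
    ⟨Finset.univ.sup r + 2, by omega, fun e => by
      have := Finset.le_sup (f := r) (Finset.mem_univ e)
      omega⟩
  let π : SubY T l → ℕ := fun y => Sum.elim (fun e => N * g (m e) + r e)
    (fun q => N * (l * p q.1 + q.2) + (N - 1)) y
  have h1 : ∀ e f, π (Sum.inl e) < π (Sum.inl f) ↔ r e < r f := by
    intro e f
    change N * g (m e) + r e < N * g (m f) + r f ↔ _
    rw [lex_lt _ _ _ _ _ (by have := hN e; omega) (by have := hN f; omega)]
    have a1 := hr e f
    have a2 := hr f e
    have b1 : m e ≤ m f → g (m e) ≤ g (m f) := fun h => hg h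
    have b2 : m f ≤ m e → g (m f) ≤ g (m e) := fun h => hg h
    omega
  have h2 : ∀ v (t : Fin l) e, π (Sum.inr (v, t)) < π (Sum.inl e) ↔ l * p v + t < g (m e) := by
    intro v t e
    change N * (l * p v + t) + (N - 1) < N * g (m e) + r e ↔ _
    have := hN e
    rw [lex_lt _ _ _ _ _ (by omega) (by omega)]
    omega
  have h3 : ∀ v (t : Fin l) e, π (Sum.inl e) < π (Sum.inr (v, t)) ↔ g (m e) ≤ l * p v + t := by
    intro v t e
    change N * g (m e) + r e < N * (l * p v + t) + (N - 1) ↔ _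
    have := hN e
    rw [lex_lt _ _ _ _ _ (by omega) (by omega)]
    omega
  have h4 : ∀ v (t : Fin l) v' (t' : Fin l), π (Sum.inr (v, t)) < π (Sum.inr (v', t')) ↔
        l * p v + t < l * p v' + t' := by
    intro v t v' t'
    change N * (l * p v + t) + (N - 1) < N * (l * p v' + t') + (N - 1) ↔ _
    rw [lex_lt _ _ _ _ _ (by omega) (by omega)]
    omega
  refine ⟨π, ?_, h1, h2, h3, h4⟩
  rintro (e | ⟨v, t⟩) (f | ⟨v', t'⟩) h
  · have a := h1 e f
    have a' := h1 f e
    rw [h] at a a'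
    have : r e = r f := by omega
    rw [hrinj this]
  · have a := h2 v' t' e
    have a' := h3 v' t' e
    rw [h] at a a'
    omega
  · have a := h2 v t f
    have a' := h3 v t f
    rw [h] at a a'
    omega
  · have a := h4 v t v' t'
    have a' := h4 v' t' v t
    rw [h] at a a'
    have e1 : l * p v + t = l * p v' + t' := by omega
    have c1 := lex_lt l (p v) (p v') t t' t.2 t'.2
    have c2 := lex_lt l (p v') (p v) t' t t'.2 t.2
    have hpv : p v = p v' := by omega
    have ht : (t : ℕ) = t' := by omega
    rw [hp hpv, Fin.ext ht]

lemma exists_shift {V : Type*} [Fintype V] (T : SimpleGraph V) (hT : T.IsAcyclic)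
    (b : ℕ) (p : V → ℕ) (hp : Injective p)
    (hband : ∀ u v, T.Adj u v → p u ≤ p v + b ∧ p v ≤ p u + b)
    (m r : T.edgeSet → ℕ) (hm : ∀ e x y, e.1 = s(x, y) → m e = p x + p y)
    (hr : ∀ e f, m e < m f → r e < r f) :
    ∃ L : ℕ → ℕ, (∀ k, L k ≤ 4 * b - 4) ∧ ∀ x y e, e.1 = s(x, y) → p y = p x + b →
      L (m e) = (halfCross T p r x e).card := by
  have key : ∀ k, ∃ n, n ≤ 4 * b - 4 ∧ ∀ x y e, e.1 = s(x, y) → p y = p x + b → m e = k →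
      n = (halfCross T p r x e).card := by
    intro k
    by_cases h : ∃ x y e, e.1 = s(x, y) ∧ p y = p x + b ∧ m e = k
    · obtain ⟨x, y, e, he, hl, hk⟩ := h
      refine ⟨_, halfCross_le T hT b p hp hband m r hm hr x e (by rw [he]; simp), ?_⟩
      intro x' y' e' he' hl' hk'
      have h1 := hm e x y he
      have h2 := hm e' x' y' he'
      have hx : x = x' := hp (by omega)
      have hy : y = y' := hp (by omega)
      have : e = e' := Subtype.ext (by rw [he, he', hx, hy])
      rw [hx, this]
    · exact ⟨0, by omega, fun x y e h1 h2 h3 => (h ⟨x, y, e, h1, h2, h3⟩).elim⟩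
  choose L hL hL' using key
  exact ⟨L, hL, fun x y e h1 h2 => hL' _ x y e h1 h2 rfl⟩

lemma core {V : Type*} [Fintype V] (T : SimpleGraph V) (hT : T.IsAcyclic)
    (b B : ℕ) (hb : 1 ≤ b) (hB : B = b ^ 2) (p : V → ℕ) (hp : Injective p)
    (hband : ∀ u v, T.Adj u v → p u ≤ p v + b ∧ p v ≤ p u + b) :
    ∃ πY : SubY T (2 * B) → ℕ, Injective πY ∧
      TwoLayerKPlanar (B * (b - 1) + 2 * b - 2) p πY (subEdges T (2 * B)) := by
  classical
  let m : T.edgeSet → ℕ := fun e => Sym2.lift ⟨fun x y => p x + p y, fun x y => add_comm _ _⟩ e.1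
  have hm : ∀ e x y, e.1 = s(x, y) → m e = p x + p y := by
    intro e x y h
    simp [m, h]
  obtain ⟨r, hrinj, hr⟩ := exists_code T m
  obtain ⟨L, hL, hLe⟩ := exists_shift T hT b p hp hband m r hm hr
  have hB4 : 4 * b - 4 ≤ B := by
    have : 4 * b ≤ b ^ 2 + 4 := by
      zify
      nlinarith [sq_nonneg ((b : ℤ) - 2)]
    omega
  have hB1 : 1 ≤ B := by rw [hB]; exact Nat.one_le_pow _ _ hb
  let g : ℕ → ℕ := fun k => B * (k + 1) + (2 * b - 2) - L k
  have hgL : ∀ k, g k + L k = B * k + B + (2 * b - 2) := by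
    intro k
    have := hL k
    have h2 : B * (k + 1) = B * k + B := by ring
    simp only [g]
    omega
  have hg : Monotone g := by
    apply monotone_nat_of_le_succ
    intro k
    have h1 := hgL k
    have h2 := hgL (k + 1)
    have h3 := hL k
    have h4 := hL (k + 1)
    have h5 : B * (k + 1) = B * k + B := by ring
    omega
  clear_value g m
  obtain ⟨π, hπ, p1, p2, p3, p4⟩ := exists_pi T (2 * B) p hp m r hr hrinj g hg
  refine ⟨π, hπ, ?_⟩
  have mono : ∀ a c, a ≤ c → B * a ≤ B * c := fun a c h => Nat.mul_le_mul_left B h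
  have mono1 : ∀ a c, a < c → B * a + B ≤ B * c := fun a c h => by
    have := Nat.mul_le_mul_left B (Nat.succ_le_of_lt h)
    rwa [Nat.mul_succ] at this
  have hgL' : ∀ e x y, e.1 = s(x, y) →
      g (m e) + L (m e) = B * p x + B * p y + B + (2 * b - 2) := by
    intro e x y h
    rw [hgL, hm e x y h]
    ring
  have dbl : ∀ a, 2 * B * a = 2 * (B * a) := fun a => by ring
  rintro ⟨x, y⟩ hxy
  rcases hxy with ⟨e, hy, hx⟩ | ⟨⟨x', t⟩, hy, hx⟩
  · simp only at hy hx
    subst hy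
    let Q : Finset (V × Fin (2 * B)) := Finset.univ.filter (fun q =>
      (p x < p q.1 ∧ 2 * B * p q.1 + q.2 < g (m e)) ∨
      (p q.1 < p x ∧ g (m e) ≤ 2 * B * p q.1 + q.2))
    have hcard : {f | f ∈ subEdges T (2 * B) ∧ cross2 p π (x, Sum.inl e) f}.ncard ≤
        (halfCross T p r x e).card + Q.card := by
      let I : Finset (V × SubY T (2 * B)) :=
        (halfCross T p r x e).image (fun q => (q.1, (Sum.inl q.2 : SubY T (2 * B)))) ∪
        Q.image (fun q => (q.1, (Sum.inr q : SubY T (2 * B))))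
      have hI : {f | f ∈ subEdges T (2 * B) ∧ cross2 p π (x, Sum.inl e) f} ⊆ (I : Set _) := by
        rintro ⟨z, w⟩ ⟨hmem, hc⟩
        rcases hmem with ⟨f, hw, hz⟩ | ⟨⟨z', t⟩, hw, hz⟩
        · simp only at hw hz
          subst hw
          simp only [cross2] at hc
          rw [p1, p1] at hc
          simp only [I, Finset.coe_union, Finset.coe_image]
          left
          exact ⟨(z, f), by simpa [halfCross] using ⟨hz, hc⟩, rfl⟩
        · simp only at hw hz
          subst hw hz
          simp only [cross2] at hc
          rw [p2, p3] at hc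
          simp only [I, Finset.coe_union, Finset.coe_image]
          right
          exact ⟨(z, t), by simpa [Q] using hc, rfl⟩
      have h1 := Set.ncard_le_ncard hI (Finset.finite_toSet I)
      rw [Set.ncard_coe_finset] at h1
      have h2 : I.card ≤ _ := Finset.card_union_le _ _
      exact h1.trans (h2.trans (add_le_add Finset.card_image_le Finset.card_image_le))
    refine hcard.trans ?_
    have hQinj : Set.InjOn (fun q : V × Fin (2 * B) => 2 * B * p q.1 + q.2) (Q : Set _) := by
      rintro ⟨v, t⟩ _ ⟨v', t'⟩ _ h
      have e1 : 2 * B * p v + t = 2 * B * p v' + t' := h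
      have c1 := lex_lt (2 * B) (p v) (p v') t t' t.2 t'.2
      have c2 := lex_lt (2 * B) (p v') (p v) t' t t'.2 t.2
      have hpv : p v = p v' := by omega
      have ht : (t : ℕ) = t' := by omega
      rw [hp hpv, Fin.ext ht]
    obtain ⟨y, hey, hme, hne, hb1, hb2⟩ := edge_other T b p hp hband m hm e x hx
    have hge := hgL' e x y hey
    have hLm := hL (m e)
    have hC := halfCross_le T hT b p hp hband m r hm hr x e hx
    have hbm : B * (b - 1) + B = B * b := by
      obtain ⟨c, rfl⟩ : ∃ c, b = c + 1 := ⟨b - 1, by omega⟩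
      simp
      ring
    have hb12 : b = 1 ∨ B ≤ B * (b - 1) := by
      rcases Nat.lt_or_ge b 2 with h | h
      · left; omega
      · right; exact Nat.le_mul_of_pos_right B (by omega)
    rcases Nat.lt_or_gt_of_ne hne with hlt | hlt
    · have m1 := mono1 _ _ hlt
      have hQ : Q.card ≤ (Finset.Ico (2 * (B * p x) + 2 * B) (g (m e))).card := by
        apply Finset.card_le_card_of_injOn _ _ hQinj
        rintro ⟨v, t⟩ hq
        simp only [Q, Finset.coe_filter, Finset.mem_univ, true_and, Set.mem_ofPred_eq] at hq
        simp only [Finset.coe_Ico, Set.mem_Ico]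
        have ht := t.2
        have n1 := mono1 (p x) (p v)
        have n2 := mono1 (p v) (p x)
        rw [dbl] at hq ⊢
        omega
      rw [Nat.card_Ico] at hQ
      by_cases hlong : p y = p x + b
      · have := hLe x y e hey hlong
        have e1 : B * p y = B * p x + B * b := by rw [hlong]; ring
        omega
      · have e1 : B * p y + B ≤ B * p x + B * b := by
          rw [← Nat.mul_add]
          exact mono1 _ _ (by omega)
        omega
    · have m1 := mono1 _ _ hlt
      have hQ : Q.card ≤ (Finset.Ico (g (m e)) (2 * (B * p x))).card := by
        apply Finset.card_le_card_of_injOn _ _ hQinj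
        rintro ⟨v, t⟩ hq
        simp only [Q, Finset.coe_filter, Finset.mem_univ, true_and, Set.mem_ofPred_eq] at hq
        simp only [Finset.coe_Ico, Set.mem_Ico]
        have ht := t.2
        have n1 := mono1 (p x) (p v)
        have n2 := mono1 (p v) (p x)
        rw [dbl] at hq ⊢
        omega
      rw [Nat.card_Ico] at hQ
      by_cases hlong : p x = p y + b
      · have hey' : e.1 = s(y, x) := by rw [hey, Sym2.eq_swap]
        have := hLe y x e hey' hlong
        have := halfCross_long T hT b p hp hband m r hm hr y x e hey' hlong
        have e1 : B * p x = B * p y + B * b := by rw [hlong]; ring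
        omega
      · have e1 : B * p x + B ≤ B * p y + B * b := by
          rw [← Nat.mul_add]
          exact mono1 _ _ (by omega)
        omega
  · simp only at hy hx
    subst hy hx
    let W : Finset (V × T.edgeSet) := Finset.univ.filter (fun q => q.1 ∈ q.2.1 ∧
      ((p x < p q.1 ∧ g (m q.2) ≤ 2 * B * p x + t) ∨
      (p q.1 < p x ∧ 2 * B * p x + t < g (m q.2))))
    have ht := t.2
    have hcard : {f | f ∈ subEdges T (2 * B) ∧ cross2 p π (x, Sum.inr (x, t)) f}.ncard ≤
        W.card := by
      let I : Finset (V × SubY T (2 * B)) :=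
        W.image (fun q => (q.1, (Sum.inl q.2 : SubY T (2 * B))))
      have hI : {f | f ∈ subEdges T (2 * B) ∧ cross2 p π (x, Sum.inr (x, t)) f} ⊆
          (I : Set _) := by
        rintro ⟨z, w⟩ ⟨hmem, hc⟩
        rcases hmem with ⟨f, hw, hz⟩ | ⟨⟨z', t'⟩, hw, hz⟩
        · simp only at hw hz
          subst hw
          simp only [cross2] at hc
          rw [p2, p3] at hc
          simp only [I, Finset.coe_image]
          exact ⟨(z, f), by simpa [W] using ⟨hz, hc⟩, rfl⟩
        · exfalso
          simp only at hw hz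
          subst hw hz
          simp only [cross2] at hc
          rw [p4, p4] at hc
          have c1 := lex_lt (2 * B) (p x) (p z) t t' t.2 t'.2
          have c2 := lex_lt (2 * B) (p z) (p x) t' t t'.2 t.2
          omega
      have h1 := Set.ncard_le_ncard hI (Finset.finite_toSet I)
      rw [Set.ncard_coe_finset] at h1
      exact h1.trans Finset.card_image_le
    refine hcard.trans ?_
    have hW : ∀ z f, (z, f) ∈ W → ∃ z', f.1 = s(z, z') ∧ p z ≤ p z' + b ∧ p z' ≤ p z + b ∧
        2 ≤ b ∧ ((p z' ≤ p x ∧ p x < p z ∧ g (m f) ≤ 2 * B * p x + t) ∨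
        (p z < p x ∧ p x ≤ p z' ∧ 2 * B * p x + t < g (m f))) := by
      intro z f hq
      simp only [W, Finset.mem_filter, Finset.mem_univ, true_and] at hq
      obtain ⟨hz, hc⟩ := hq
      obtain ⟨z', h1, h2, h3, h4, h5⟩ := edge_other T b p hp hband m hm f z hz
      have hgf := hgL' f z z' h1
      have hLf := hL (m f)
      have n1 := mono1 (p x) (p z)
      have n2 := mono1 (p z) (p x)
      have n3 := mono1 (p x) (p z')
      have n4 := mono1 (p z') (p x)
      have n5 : p x = p z' → B * p x = B * p z' := fun h => by rw [h]
      refine ⟨z', h1, h4, h5, ?_, ?_⟩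
      · by_contra hb2
        have hb' : b = 1 := by omega
        subst hb'
        have hB' : B = 1 := by simpa using hB
        subst hB'
        omega
      · rw [dbl] at hc ⊢
        omega
    rcases Nat.lt_or_ge b 2 with hb2 | hb2
    · have : W = ∅ := by
        rw [Finset.eq_empty_iff_forall_notMem]
        rintro ⟨z, f⟩ hq
        obtain ⟨z', -, -, -, h, -⟩ := hW z f hq
        omega
      rw [this]
      simp
    · have hWF : W.card = (W.image Prod.snd).card := by
        rw [Finset.card_image_of_injOn]
        rintro ⟨z, f⟩ hq ⟨z', f'⟩ hq' h
        simp only at h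
        subst h
        obtain ⟨u, hu, -, -, -, h1⟩ := hW z f hq
        obtain ⟨u', hu', -, -, -, h2⟩ := hW z' f hq'
        rw [hu, Sym2.eq_iff] at hu'
        rcases hu' with ⟨rfl, -⟩ | ⟨rfl, rfl⟩
        · rfl
        · omega
      have hF := forest_window T hT p hp (W.image Prod.snd) b (p x) (2 * b + 1) (by omega) (by
        intro f hf v hv
        rw [Finset.mem_image] at hf
        obtain ⟨⟨z, f'⟩, hq, rfl⟩ := hf
        obtain ⟨z', h1, h2, h3, h4, h5⟩ := hW z f' hq
        simp only at hv
        rw [h1, Sym2.mem_iff] at hv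
        rcases hv with rfl | rfl <;> omega)
      have h1 : B * 1 ≤ B * (b - 1) := mono _ _ (by omega)
      omega

/-- If a tree `T` has a vertex order `σ` of bandwidth at most `b`, then the
graph obtained from `T` by subdividing every edge once and attaching `ℓ = 2b²`
leaves to each original vertex admits a 2-layer `k`-planar drawing with
`k = ℓ(b-1)/2 + 2b - 2 = b²(b-1) + 2b - 2`, with `X = V(T)` ordered by `σ`. -/
theorem stmt11 {V : Type*} [Fintype V] (T : SimpleGraph V) (hT : T.IsTree)
    (b : ℕ) (σ : V ≃ Fin (Fintype.card V))
    (hband : ∀ u v, T.Adj u v →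
      (σ u : ℕ) ≤ (σ v : ℕ) + b ∧ (σ v : ℕ) ≤ (σ u : ℕ) + b) :
    ∃ πY : SubY T (2 * b ^ 2) → ℕ, Injective πY ∧
      TwoLayerKPlanar (b ^ 2 * (b - 1) + 2 * b - 2)
        (fun v => (σ v : ℕ)) πY (subEdges T (2 * b ^ 2)) := by
  rcases Nat.eq_zero_or_pos b with rfl | hb
  · have hno : ∀ e : T.edgeSet, False := by
      rintro ⟨e, he⟩
      induction e using Sym2.ind with
      | _ x y =>
        have hadj : T.Adj x y := he
        have := hband x y hadj
        exact hadj.ne (σ.injective (Fin.ext (by omega)))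
    have hemp : ∀ y : SubY T (2 * 0 ^ 2), False := by
      rintro (e | ⟨v, t⟩)
      · exact hno e
      · exact absurd t.2 (by simp)
    exact ⟨fun _ => 0, fun y => (hemp y).elim, fun e => (hemp e.2).elim⟩
  · exact core T hT.isAcyclic b (b ^ 2) hb rfl (fun v => (σ v : ℕ))
      (fun u v h => σ.injective (Fin.ext h)) hband
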